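/- Let β, γ > 0 and α = 2β. The function G(x, y, z) = xyz/(x + y + z)³ is a constant of motion on the open positive orthant ℝ³₊ for the symmetric mass-action system ẋ = x(γ − βx − αy), ẏ = y(γ − βy − αz), ż = z(γ − βz − αx): for every differentiable solution t ↦ (x(t), y(t), z(t)) with x, y, z > 0, the function t ↦ x(t)y(t)z(t)/(x(t) + y(t) + z(t))³ is constant. -/

import Mathlib

/-- For α = 2β, the function G(x,y,z) = xyz/(x+y+z)³ is a constant of motion on the
open positive orthant for the symmetric mass-action system
ẋ = x(γ − βx − αy), ẏ = y(γ − βy − αz), ż = z(γ − βz − αx). -/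
theorem symmetric_system_constant_of_motion
    (β γ : ℝ) (hβ : 0 < β) (hγ : 0 < γ)
    (α : ℝ) (hα : α = 2 * β)
    (x y z : ℝ → ℝ)
    (hode : ∀ t : ℝ,
      HasDerivAt x (x t * (γ - β * x t - α * y t)) t ∧
      HasDerivAt y (y t * (γ - β * y t - α * z t)) t ∧
      HasDerivAt z (z t * (γ - β * z t - α * x t)) t)
    (hpos : ∀ t : ℝ, 0 < x t ∧ 0 < y t ∧ 0 < z t) :
    ∀ s t : ℝ,
      x s * y s * z s / (x s + y s + z s) ^ 3 =
        x t * y t * z t / (x t + y t + z t) ^ 3 := by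
  have key : ∀ t : ℝ, HasDerivAt
      (fun t => x t * y t * z t / (x t + y t + z t) ^ 3) 0 t := by
    intro t
    obtain ⟨h1, h2, h3⟩ := hode t
    obtain ⟨p1, p2, p3⟩ := hpos t
    have hS : x t + y t + z t ≠ 0 := by positivity
    have hne : ((x + y + z) ^ 3) t ≠ 0 := pow_ne_zero 3 hS
    have h := ((h1.mul h2).mul h3).div (((h1.add h2).add h3).pow 3) hne
    refine HasDerivAt.congr_deriv h ?_
    rw [div_eq_zero_iff]
    left
    simp only [Pi.mul_apply, Pi.add_apply, Pi.pow_apply]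
    subst hα
    push_cast
    ring
  intro s t
  exact is_const_of_deriv_eq_zero (fun t => (key t).differentiableAt)
    (fun t => (key t).deriv) s t
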